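/- Let n be an even natural number and let f, g be complex-valued functions on the two-element subsets of {1,…,n}. Then Σ_{M ∈ P({1,…,n})} ∏_{e∈M} (f(e) + g(e)) = Σ_{S ⊆ {1,…,n}} ( Σ_{M_1 ∈ P({1,…,n}∖S)} ∏_{e∈M_1} f(e) ) · ( Σ_{M_2 ∈ P(S)} ∏_{e∈M_2} g(e) ), where the sum over S ranges over all subsets of {1,…,n} (subsets of odd cardinality contribute zero since P of an odd-cardinality set is empty). -/

import Mathlib

noncomputable section

/-- A partition of the finite set `s` into two-element subsets (a perfect matching). -/
def IsPairing {α : Type*} [DecidableEq α] (s : Finset α) (M : Finset (Finset α)) : Prop :=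
  (∀ e ∈ M, e.card = 2) ∧ (∀ e ∈ M, ∀ f ∈ M, e ≠ f → Disjoint e f) ∧ M.sup id = s

open Classical in
/-- The finite set of all partitions of `s` into two-element subsets. -/
def pairings {α : Type*} [DecidableEq α] (s : Finset α) : Finset (Finset (Finset α)) :=
  s.powerset.powerset.filter (IsPairing s)

end

theorem mem_pairings {α : Type*} [DecidableEq α] {s : Finset α} {M : Finset (Finset α)} :
    M ∈ pairings s ↔ IsPairing s M := by
  simp only [pairings, Finset.mem_filter, Finset.mem_powerset, and_iff_right_iff_imp]
  rintro ⟨-, -, rfl⟩ e he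
  exact Finset.mem_powerset.2 (Finset.le_sup (f := id) he)

namespace IsPairing

variable {α : Type*} [DecidableEq α] {s t : Finset α} {M N : Finset (Finset α)}

theorem subset_of_mem (hM : IsPairing s M) {e : Finset α} (he : e ∈ M) : e ⊆ s :=
  hM.2.2 ▸ Finset.le_sup (f := id) he

theorem mono (hM : IsPairing s M) (h : N ⊆ M) : IsPairing (N.sup id) N :=
  ⟨fun e he => hM.1 e (h he), fun e he e' he' => hM.2.1 e (h he) e' (h he'), rfl⟩

theorem disjoint (hM : IsPairing s M) (hN : IsPairing t N) (h : Disjoint s t) :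
    Disjoint M N := by
  refine Finset.disjoint_left.2 fun e he he' => ?_
  have hempty : e = ∅ := Finset.disjoint_self_iff_empty e |>.1
    (h.mono (hM.subset_of_mem he) (hN.subset_of_mem he'))
  simpa [hempty] using hM.1 e he

theorem union (hM : IsPairing s M) (hN : IsPairing t N) (h : Disjoint s t) :
    IsPairing (s ∪ t) (M ∪ N) := by
  refine ⟨fun e he => ?_, fun e he e' he' hne => ?_, ?_⟩
  · exact (Finset.mem_union.1 he).elim (hM.1 e) (hN.1 e)
  · rcases Finset.mem_union.1 he with he | he <;> rcases Finset.mem_union.1 he' with he' | he'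
    · exact hM.2.1 e he e' he' hne
    · exact h.mono (hM.subset_of_mem he) (hN.subset_of_mem he')
    · exact h.symm.mono (hN.subset_of_mem he) (hM.subset_of_mem he')
    · exact hN.2.1 e he e' he' hne
  · rw [Finset.sup_union, hM.2.2, hN.2.2, Finset.sup_eq_union]

theorem sup_eq_sdiff (hM : IsPairing s M) (h : N ⊆ M) : N.sup id = s \ (M \ N).sup id := by
  have hdisj : Disjoint (N.sup id) ((M \ N).sup id) := by
    refine Finset.disjoint_sup_left.2 fun e he => Finset.disjoint_sup_right.2 fun e' he' => ?_
    have he' := Finset.mem_sdiff.1 he'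
    exact hM.2.1 e (h he) e' he'.1 fun heq => he'.2 (heq ▸ he)
  rw [← hM.2.2, ← Finset.union_sdiff_of_subset h, Finset.sup_union, Finset.sup_eq_union,
    Finset.union_sdiff_of_subset h, Finset.union_sdiff_cancel_right hdisj]

end IsPairing

theorem sum_pairings_prod_add {α R : Type*} [DecidableEq α] [CommSemiring R] (s : Finset α)
    (f g : Finset α → R) :
    (∑ M ∈ pairings s, ∏ e ∈ M, (f e + g e))
      = ∑ S ∈ s.powerset, (∑ M₁ ∈ pairings (s \ S), ∏ e ∈ M₁, f e) *
          (∑ M₂ ∈ pairings S, ∏ e ∈ M₂, g e) := by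
  simp only [Finset.prod_add, Finset.sum_mul_sum, ← Finset.sum_product', Finset.sum_sigma']
  refine Finset.sum_bij'
    (fun x _ => ⟨(x.1 \ x.2).sup id, x.2, x.1 \ x.2⟩)
    (fun y _ => ⟨y.2.1 ∪ y.2.2, y.2.1⟩) ?_ ?_ ?_ ?_ ?_
  · rintro ⟨M, N⟩ h
    simp only [Finset.mem_sigma, Finset.mem_powerset, Finset.mem_product, mem_pairings] at h ⊢
    obtain ⟨hM, hN⟩ := h
    refine ⟨Finset.sup_le fun e he => hM.subset_of_mem (Finset.sdiff_subset he), ?_,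
      hM.mono Finset.sdiff_subset⟩
    exact hM.sup_eq_sdiff hN ▸ hM.mono hN
  · rintro ⟨S, M, N⟩ h
    simp only [Finset.mem_sigma, Finset.mem_powerset, Finset.mem_product, mem_pairings] at h ⊢
    obtain ⟨hS, hM, hN⟩ := h
    refine ⟨?_, Finset.subset_union_left⟩
    simpa [Finset.sdiff_union_of_subset hS] using hM.union hN Finset.sdiff_disjoint
  · rintro ⟨M, N⟩ h
    simp only [Finset.mem_sigma, Finset.mem_powerset] at h
    simp [Finset.union_eq_right.2 h.2]
  · rintro ⟨S, M, N⟩ h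
    simp only [Finset.mem_sigma, Finset.mem_product, mem_pairings] at h
    obtain ⟨-, hM, hN⟩ := h
    simp [Finset.union_sdiff_cancel_left (hM.disjoint hN Finset.sdiff_disjoint), hN.2.2]
  · exact fun _ _ => rfl

/-- Binomial-type expansion of a sum over perfect matchings of `{1, …, n}` of
products of `f + g` into sums over complementary pairs of matchings. -/
theorem statement7 (n : ℕ) (hn : Even n) (f g : Finset ℕ → ℂ) :
    (∑ M ∈ pairings (Finset.Icc 1 n), ∏ e ∈ M, (f e + g e))
      = ∑ S ∈ (Finset.Icc 1 n).powerset,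
          (∑ M₁ ∈ pairings (Finset.Icc 1 n \ S), ∏ e ∈ M₁, f e) *
            (∑ M₂ ∈ pairings S, ∏ e ∈ M₂, g e) := by
  exact sum_pairings_prod_add _ f g
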